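/- Let x be a unit vector in ℝ^d with ⟨x, v₁⟩ ≥ a for some a > 0, let γ ≥ 2λ₁ and 0 < η ≤ a/γ, and let q ∈ ℝ^d satisfy ⟨q, x⟩ = 0 and η‖q‖ ≤ π. Then the inexact Riemannian gradient step x' = exp_x(−ηq) satisfies dist(x', v₁) ≤ η·‖q − grad f(x)‖ + √(1 − aμη)·dist(x, v₁), where μ = δ/2 and f(x) = −xᵀAx. -/

import Mathlib

open RealInnerProductSpace
open scoped Classical

/-- The geodesic distance on the unit sphere: `dist(p,q) = arccos⟨p,q⟩`. -/
noncomputable def sphereDist {d : ℕ} (p q : EuclideanSpace ℝ (Fin d)) : ℝ :=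
  Real.arccos ⟪p, q⟫

/-- The exponential map of the unit sphere at `x`:
`exp_x(u) = cos(‖u‖)x + sin(‖u‖)u/‖u‖` for `u ≠ 0`, and `exp_x(0) = x`. -/
noncomputable def sphereExp {d : ℕ} (x u : EuclideanSpace ℝ (Fin d)) :
    EuclideanSpace ℝ (Fin d) :=
  if u = 0 then x else Real.cos ‖u‖ • x + (Real.sin ‖u‖ / ‖u‖) • u

/-- `z ↦ cos √z` is convex on `[0, π²]`. -/
theorem convexOn_cos_sqrt :
    ConvexOn ℝ (Set.Icc 0 (Real.pi ^ 2)) fun z : ℝ => Real.cos (√z) := by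
  have hderiv : ∀ z ∈ Set.Ioo (0 : ℝ) (Real.pi ^ 2),
      HasDerivAt (fun z : ℝ => Real.cos (√z)) (-Real.sin (√z) * (1 / (2 * √z))) z :=
    fun z hz => (Real.hasDerivAt_sqrt hz.1.ne').cos
  refine MonotoneOn.convexOn_of_deriv (convex_Icc _ _)
    (Real.continuous_cos.comp Real.continuous_sqrt).continuousOn ?_ ?_
  · rw [interior_Icc]
    exact fun z hz => (hderiv z hz).differentiableAt.differentiableWithinAt
  · rw [interior_Icc]
    intro y hy z hz hyz
    rw [(hderiv y hy).deriv, (hderiv z hz).deriv]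
    have hy0 : 0 < √y := Real.sqrt_pos.2 hy.1
    have hz0 : 0 < √z := Real.sqrt_pos.2 hz.1
    have hle : √y ≤ √z := Real.sqrt_le_sqrt hyz
    have hzπ : √z ≤ Real.pi := Real.sqrt_le_iff.2 ⟨Real.pi_pos.le, hz.2.le⟩
    have hconc := strictConcaveOn_sin_Icc.concaveOn.2
      (Set.left_mem_Icc.2 Real.pi_pos.le) (⟨hz0.le, hzπ⟩ : √z ∈ Set.Icc 0 Real.pi)
      (sub_nonneg.2 ((div_le_one hz0).2 hle)) (div_nonneg hy0.le hz0.le) (by ring)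
    simp only [smul_eq_mul, mul_zero, Real.sin_zero, zero_add, div_mul_cancel₀ _ hz0.ne'] at hconc
    have hsin : Real.sin (√z) / √z ≤ Real.sin (√y) / √y := by
      rw [le_div_iff₀ hy0]
      calc _ = √y / √z * Real.sin (√z) := by ring
        _ ≤ _ := hconc
    have e : ∀ t : ℝ, -Real.sin t * (1 / (2 * t)) = -(Real.sin t / t) / 2 := by
      intro t; rw [one_div, mul_inv]; ring
    rw [e, e]
    linarith

/-- Comparison of the spherical and the Euclidean law of cosines: the side of a spherical triangle
is at most the corresponding side of the planar triangle with the same angle. -/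
theorem arccos_cos_mul_cos_add_le_sqrt {r θ k : ℝ} (hr : r ∈ Set.Icc 0 Real.pi)
    (hθ : θ ∈ Set.Icc 0 Real.pi) (hk : k ∈ Set.Icc (-1) 1) :
    Real.arccos (Real.cos r * Real.cos θ + k * (Real.sin r * Real.sin θ)) ≤
      √(r ^ 2 + θ ^ 2 - 2 * (r * θ * k)) := by
  obtain ⟨hr0, hrπ⟩ := hr
  obtain ⟨hθ0, hθπ⟩ := hθ
  obtain ⟨hk1, hk2⟩ := hk
  have hπ := Real.pi_pos
  set z := r ^ 2 + θ ^ 2 - 2 * (r * θ * k) with hz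
  rcases le_total Real.pi (√z) with h | h
  · exact (Real.arccos_le_pi _).trans h
  have hzπ : z ≤ Real.pi ^ 2 := (Real.sqrt_le_left hπ.le).1 h
  suffices hcos : Real.cos (√z) ≤
      Real.cos r * Real.cos θ + k * (Real.sin r * Real.sin θ) by
    calc _ ≤ Real.arccos (Real.cos (√z)) := Real.arccos_le_arccos hcos
      _ = √z := Real.arccos_cos (Real.sqrt_nonneg _) h
  have hsub : (r - θ) ^ 2 ∈ Set.Icc 0 (Real.pi ^ 2) :=
    ⟨sq_nonneg _, sq_le_sq' (by linarith) (by linarith)⟩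
  have hcsub : Real.cos (√((r - θ) ^ 2)) =
      Real.cos r * Real.cos θ + Real.sin r * Real.sin θ := by
    rw [Real.sqrt_sq_eq_abs, Real.cos_abs, Real.cos_sub]
  rcases le_or_gt (r + θ) Real.pi with hs | hs
  · have hadd : (r + θ) ^ 2 ∈ Set.Icc 0 (Real.pi ^ 2) :=
      ⟨sq_nonneg _, sq_le_sq' (by linarith) hs⟩
    have hc := convexOn_cos_sqrt.2 hadd hsub (by linarith : 0 ≤ (1 - k) / 2)
      (by linarith : 0 ≤ (1 + k) / 2) (by ring)
    simp only [smul_eq_mul] at hc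
    rw [hcsub, Real.sqrt_sq (by linarith : 0 ≤ r + θ), Real.cos_add,
      show (1 - k) / 2 * (r + θ) ^ 2 + (1 + k) / 2 * (r - θ) ^ 2 = z by rw [hz]; ring] at hc
    linarith
  · have hr1 : 0 < r := by linarith
    have hθ1 : 0 < θ := by linarith
    have hrθ : 0 < 2 * (r * θ) := by positivity
    have hsq : (r - θ) ^ 2 < Real.pi ^ 2 := sq_lt_sq' (by linarith) (by linarith)
    have hsq' : Real.pi ^ 2 < (r + θ) ^ 2 := sq_lt_sq' (by linarith) hs
    have hden : 0 < Real.pi ^ 2 - (r - θ) ^ 2 := by linarith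
    set β := (z - (r - θ) ^ 2) / (Real.pi ^ 2 - (r - θ) ^ 2) with hβ
    have hzsub : z - (r - θ) ^ 2 = 2 * (r * θ) * (1 - k) := by rw [hz]; ring
    have hβ0 : 0 ≤ β := div_nonneg (by rw [hzsub]; exact mul_nonneg hrθ.le (by linarith)) hden.le
    have hβ1 : β ≤ 1 := (div_le_one hden).2 (by linarith)
    have hβz : β * (Real.pi ^ 2 - (r - θ) ^ 2) = 2 * (r * θ) * (1 - k) := by
      rw [hβ, div_mul_cancel₀ _ hden.ne', hzsub]
    have hc := convexOn_cos_sqrt.2 (Set.right_mem_Icc.2 (sq_nonneg Real.pi)) hsub hβ0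
      (sub_nonneg.2 hβ1) (by ring)
    simp only [smul_eq_mul] at hc
    rw [hcsub, Real.sqrt_sq hπ.le, Real.cos_pi,
      show β * Real.pi ^ 2 + (1 - β) * (r - θ) ^ 2 = z by linarith] at hc
    have hkβ : 1 - k ≤ 2 * β := by
      have h1 : β * (Real.pi ^ 2 - (r - θ) ^ 2) ≤ β * (4 * (r * θ)) :=
        mul_le_mul_of_nonneg_left (by linarith) hβ0
      by_contra! hcon
      nlinarith
    have hss : 0 ≤ Real.sin r * Real.sin θ :=
      mul_nonneg (Real.sin_nonneg_of_nonneg_of_le_pi hr0 hrπ)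
        (Real.sin_nonneg_of_nonneg_of_le_pi hθ0 hθπ)
    have hadd : 0 ≤ β * (1 + Real.cos (r + θ)) :=
      mul_nonneg hβ0 (by linarith [Real.neg_one_le_cos (r + θ)])
    rw [Real.cos_add] at hadd
    have hS := mul_le_mul_of_nonneg_right hkβ hss
    nlinarith

/-- The distance from `exp_x u` to `v` is at most the distance from `u` to `log_x v` in the tangent
space at `x`. -/
theorem sphereDist_sphereExp_le {d : ℕ} {x v u : EuclideanSpace ℝ (Fin d)} (hx : ‖x‖ = 1)
    (hv : ‖v‖ = 1) (hxv : -1 < ⟪x, v⟫) (hux : ⟪u, x⟫ = 0) (hu : ‖u‖ ≤ Real.pi) :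
    sphereDist (sphereExp x u) v ≤
      ‖u - (sphereDist x v / Real.sin (sphereDist x v)) • (v - ⟪x, v⟫ • x)‖ := by
  set c := ⟪x, v⟫ with hc
  have hc1 : c ≤ 1 := by simpa [hx, hv] using real_inner_le_norm x v
  set θ := sphereDist x v with hθ
  have hθ0 : 0 ≤ θ := Real.arccos_nonneg _
  have hθπ : θ < Real.pi := by
    refine lt_of_le_of_ne (Real.arccos_le_pi _) fun h => ?_
    have := Real.arccos_eq_pi.1 h
    linarith
  have hcos : Real.cos θ = c := Real.cos_arccos hxv.le hc1
  have hsin : Real.sin θ ^ 2 = 1 - c ^ 2 := by rw [Real.sin_sq, hcos]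
  have hxx : ⟪x, x⟫ = 1 := by rw [real_inner_self_eq_norm_sq, hx, one_pow]
  have hvv : ⟪v, v⟫ = 1 := by rw [real_inner_self_eq_norm_sq, hv, one_pow]
  have hy : ‖v - c • x‖ ^ 2 = Real.sin θ ^ 2 := by
    rw [hsin, ← real_inner_self_eq_norm_sq, inner_sub_left, inner_sub_right, inner_sub_right]
    simp only [real_inner_smul_left, real_inner_smul_right, hxx, hvv, real_inner_comm x v]
    rw [← hc]
    ring
  set w := (θ / Real.sin θ) • (v - c • x) with hw
  have hratio : θ / Real.sin θ * Real.sin θ = θ := by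
    rcases hθ0.eq_or_lt with h | h
    · simp [← h]
    · exact div_mul_cancel₀ _ (Real.sin_pos_of_pos_of_lt_pi h hθπ).ne'
  have hwn : ‖w‖ ^ 2 = θ ^ 2 := by
    rw [hw, norm_smul, mul_pow, hy, Real.norm_eq_abs, sq_abs, ← mul_pow, hratio]
  have hwn' : ‖w‖ = θ := (sq_eq_sq₀ (norm_nonneg _) hθ0).1 hwn
  have hsw : Real.sin θ * ⟪u, w⟫ = θ * ⟪u, v⟫ := by
    rw [hw, real_inner_smul_right, inner_sub_right, real_inner_smul_right, hux, ← mul_assoc,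
      mul_comm (Real.sin θ), hratio]
    ring
  have hk := abs_real_inner_div_norm_mul_norm_le_one u w
  have hmain := arccos_cos_mul_cos_add_le_sqrt ⟨norm_nonneg u, hu⟩ ⟨hθ0, hθπ.le⟩ (abs_le.1 hk)
  have hkm : ‖u‖ * θ * (⟪u, w⟫ / (‖u‖ * ‖w‖)) = ⟪u, w⟫ := by
    rw [← hwn']
    rcases eq_or_ne (‖u‖ * ‖w‖) 0 with h | h
    · rw [h, zero_mul]
      exact (abs_nonpos_iff.1 (h ▸ abs_real_inner_le_norm u w)).symm
    · exact mul_div_cancel₀ _ h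
  have hnorm : ‖u - w‖ = √(‖u‖ ^ 2 + θ ^ 2 - 2 * (‖u‖ * θ * (⟪u, w⟫ / (‖u‖ * ‖w‖)))) := by
    rw [hkm, ← hwn, ← Real.sqrt_sq (norm_nonneg (u - w)), norm_sub_sq_real]
    congr 1
    ring
  rw [hnorm]
  refine le_trans (le_of_eq ?_) hmain
  rw [sphereDist]
  congr 1
  rw [sphereExp]
  split_ifs with h0
  · simp [h0, hcos, ← hc]
  · have hu0 : ‖u‖ ≠ 0 := norm_ne_zero_iff.2 h0
    rw [inner_add_left, real_inner_smul_left, real_inner_smul_left, ← hc, hcos, hwn']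
    congr 1
    rcases eq_or_ne θ 0 with h | h
    · have hv0 : v - c • x = 0 := by
        rw [h, Real.sin_zero, zero_pow two_ne_zero] at hy
        exact norm_eq_zero.1 (pow_eq_zero_iff two_ne_zero |>.1 hy)
      rw [sub_eq_zero.1 hv0, real_inner_smul_right, hux, h]
      simp
    · field_simp
      linear_combination -Real.sin ‖u‖ * hsw

/-- A positive semidefinite symmetric operator with Rayleigh quotient at most `l` satisfies
`‖A u‖² ≤ l ⟨u, A u⟩`. -/
theorem norm_sq_apply_le_mul_inner {E : Type*} [NormedAddCommGroup E] [InnerProductSpace ℝ E]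
    (A : E →ₗ[ℝ] E) (hsymm : ∀ u w, ⟪A u, w⟫ = ⟪u, A w⟫) (hpsd : ∀ u, 0 ≤ ⟪u, A u⟫) {l : ℝ}
    (hl : 0 < l) (hmax : ∀ u : E, ⟪u, A u⟫ ≤ l * ‖u‖ ^ 2) (u : E) :
    ‖A u‖ ^ 2 ≤ l * ⟪u, A u⟫ := by
  have h := hpsd (l • u - A u)
  have h2 := hmax (A u)
  rw [map_sub, map_smul, inner_sub_left, inner_sub_right, inner_sub_right] at h
  simp only [real_inner_smul_left, real_inner_smul_right] at h
  rw [← hsymm u (A u), real_inner_self_eq_norm_sq] at h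
  refine le_of_mul_le_mul_left ?_ hl
  linarith

/-- A bound on the Rayleigh quotient at the normalization of `u` gives one at `u`. -/
theorem inner_apply_le_mul_norm_sq {E : Type*} [NormedAddCommGroup E] [InnerProductSpace ℝ E]
    (A : E →ₗ[ℝ] E) {l : ℝ} {u : E} (h : ‖‖u‖⁻¹ • u‖ = 1 → ⟪‖u‖⁻¹ • u, A (‖u‖⁻¹ • u)⟫ ≤ l) :
    ⟪u, A u⟫ ≤ l * ‖u‖ ^ 2 := by
  rcases eq_or_ne u 0 with rfl | hu
  · simp
  have hn : 0 < ‖u‖ := norm_pos_iff.2 hu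
  have h1 := h (by rw [norm_smul, norm_inv, norm_norm, inv_mul_cancel₀ hn.ne'])
  rw [map_smul, real_inner_smul_left, real_inner_smul_right] at h1
  calc ⟪u, A u⟫ = ‖u‖⁻¹ * (‖u‖⁻¹ * ⟪u, A u⟫) * ‖u‖ ^ 2 := by field_simp
    _ ≤ _ := mul_le_mul_of_nonneg_right h1 (sq_nonneg _)

/-- an inexact Riemannian gradient step for `f(x) = −xᵀAx`.
If `x` is a unit vector with `⟨x,v₁⟩ ≥ a > 0`, `γ ≥ 2λ₁`, `0 < η ≤ a/γ`, and
`q` is tangent at `x` (`⟨q,x⟩ = 0`) with `η‖q‖ ≤ π`, then `x' = exp_x(−ηq)`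
satisfies `dist(x',v₁) ≤ η‖q − grad f(x)‖ + √(1 − aμη)·dist(x,v₁)` where
`μ = δ/2`, `δ = λ₁ − λ₂ > 0`, `grad f(x) = 2(xᵀAx)x − 2Ax`. -/
theorem stmt_12 {d : ℕ} (hd : 2 ≤ d)
    (A : EuclideanSpace ℝ (Fin d) →ₗ[ℝ] EuclideanSpace ℝ (Fin d))
    (hsymm : ∀ u w, ⟪A u, w⟫ = ⟪u, A w⟫)
    (hpsd : ∀ u, 0 ≤ ⟪u, A u⟫)
    (v₁ : EuclideanSpace ℝ (Fin d)) (l₁ l₂ : ℝ)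
    (hv₁ : ‖v₁‖ = 1) (hAv₁ : A v₁ = l₁ • v₁)
    (hmax : ∀ u : EuclideanSpace ℝ (Fin d), ‖u‖ = 1 → ⟪u, A u⟫ ≤ l₁)
    (hl₂ : ∀ w : EuclideanSpace ℝ (Fin d), ‖w‖ = 1 → ⟪w, v₁⟫ = 0 → ⟪w, A w⟫ ≤ l₂)
    (hgap : 0 < l₁ - l₂)
    (a : ℝ) (ha : 0 < a)
    (x : EuclideanSpace ℝ (Fin d)) (hx : ‖x‖ = 1) (hxa : a ≤ ⟪x, v₁⟫)
    (γ η : ℝ) (hγ : 2 * l₁ ≤ γ) (hη0 : 0 < η) (hη : η ≤ a / γ)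
    (q : EuclideanSpace ℝ (Fin d)) (hqx : ⟪q, x⟫ = 0)
    (hqπ : η * ‖q‖ ≤ Real.pi)
    (x' : EuclideanSpace ℝ (Fin d)) (hx' : x' = sphereExp x (-η • q)) :
    sphereDist x' v₁ ≤
      η * ‖q - ((2 * ⟪x, A x⟫) • x - (2 : ℝ) • A x)‖ +
        Real.sqrt (1 - a * ((l₁ - l₂) / 2) * η) * sphereDist x v₁ := by
  subst hx'
  set c := ⟪x, v₁⟫ with hc
  set θ := sphereDist x v₁ with hθ
  set m := ⟪x, A x⟫ with hm
  set g := (2 * m) • x - (2 : ℝ) • A x with hg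
  have hc0 : 0 < c := ha.trans_le hxa
  have hc1 : c ≤ 1 := by simpa [hx, hv₁] using real_inner_le_norm x v₁
  have hxx : ⟪x, x⟫ = 1 := by rw [real_inner_self_eq_norm_sq, hx, one_pow]
  have hvv : ⟪v₁, v₁⟫ = 1 := by rw [real_inner_self_eq_norm_sq, hv₁, one_pow]
  have hvx : ⟪v₁, x⟫ = c := real_inner_comm _ _
  have hvA : ⟪A x, v₁⟫ = l₁ * c := by rw [hsymm, hAv₁, real_inner_smul_right]
  have hAxx : ⟪A x, x⟫ = m := real_inner_comm _ _
  have hml : m ≤ l₁ := hmax x hx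
  have hm0 : 0 ≤ m := hpsd x
  have hθ0 : 0 ≤ θ := Real.arccos_nonneg _
  have hθ2 : θ ≤ Real.pi / 2 := Real.arccos_le_pi_div_two.2 hc0.le
  have hcos : Real.cos θ = c := Real.cos_arccos (by linarith) hc1
  set s := Real.sin θ with hs
  have hs2 : s ^ 2 = 1 - c ^ 2 := by rw [hs, Real.sin_sq, hcos]
  set w := (θ / s) • (v₁ - c • x) with hw
  have hη_q : ‖-η • q‖ = η * ‖q‖ := by rw [norm_smul, norm_neg, Real.norm_of_nonneg hη0.le]
  have hstep := sphereDist_sphereExp_le (u := -η • q) hx hv₁ (by linarith)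
    (by rw [real_inner_smul_left, hqx, mul_zero]) (hη_q.trans_le hqπ)
  have htri : ‖-η • q - w‖ ≤ η * ‖q - g‖ + ‖η • g + w‖ := by
    have e : -η • q - w = -(η • (q - g)) - (η • g + w) := by
      rw [neg_smul, smul_sub]; abel
    rw [e]
    refine (norm_sub_le _ _).trans_eq ?_
    rw [norm_neg, norm_smul, Real.norm_of_nonneg hη0.le]
  refine hstep.trans (htri.trans (add_le_add_right ?_ _))
  suffices hsq : ‖η • g + w‖ ^ 2 ≤ (1 - a * ((l₁ - l₂) / 2) * η) * θ ^ 2 by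
    calc ‖η • g + w‖ ≤ √((1 - a * ((l₁ - l₂) / 2) * η) * θ ^ 2) := Real.le_sqrt_of_sq_le hsq
      _ = _ := by rw [Real.sqrt_mul' _ (sq_nonneg θ), Real.sqrt_sq hθ0]
  have hp : m - l₁ * c ^ 2 ≤ l₂ * s ^ 2 := by
    have h := inner_apply_le_mul_norm_sq A (l := l₂) (u := x - c • v₁) fun h => hl₂ _ h (by
      rw [real_inner_smul_left, inner_sub_left, real_inner_smul_left, hvv, ← hc]; ring)
    rw [← real_inner_self_eq_norm_sq, map_sub, map_smul, hAv₁] at h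
    simp only [inner_sub_left, inner_sub_right, real_inner_smul_left, real_inner_smul_right,
      hxx, hvv, ← hc, ← hm, hvx] at h
    rw [← hsymm v₁ x, hAv₁, real_inner_smul_left, hvx] at h
    rw [hs2]
    linarith
  have hG : ‖g‖ ^ 2 = 4 * (‖A x‖ ^ 2 - m ^ 2) := by
    rw [← real_inner_self_eq_norm_sq, ← real_inner_self_eq_norm_sq, hg]
    simp only [inner_sub_left, inner_sub_right, real_inner_smul_left, real_inner_smul_right,
      hxx, hAxx, ← hm]
    ring
  have hgw : ⟪g, w⟫ = -(θ / s * (2 * c * (l₁ - m))) := by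
    rw [hw, hg]
    simp only [inner_sub_left, inner_sub_right, real_inner_smul_left, real_inner_smul_right,
      hxx, hAxx, ← hc, hvA]
    ring
  have hy : ‖v₁ - c • x‖ ^ 2 = s ^ 2 := by
    rw [hs2, ← real_inner_self_eq_norm_sq]
    simp only [inner_sub_left, inner_sub_right, real_inner_smul_left, real_inner_smul_right,
      hxx, hvv, hvx, ← hc]
    ring
  have hexp : ‖η • g + w‖ ^ 2 = η ^ 2 * ‖g‖ ^ 2 + 2 * η * ⟪g, w⟫ + ‖w‖ ^ 2 := by
    rw [norm_add_sq_real, norm_smul, real_inner_smul_left, mul_pow, Real.norm_eq_abs, sq_abs]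
    ring
  rcases hθ0.eq_or_lt with h0 | hpos
  · have hs0 : s = 0 := by rw [hs, ← h0, Real.sin_zero]
    have hc1' : c = 1 := by rw [← hcos, ← h0, Real.cos_zero]
    have hxv : v₁ = x := by
      rw [hs0, zero_pow two_ne_zero, hc1', one_smul] at hy
      exact sub_eq_zero.1 (norm_eq_zero.1 (pow_eq_zero_iff two_ne_zero |>.1 hy))
    have hAx : A x = l₁ • x := hxv ▸ hAv₁
    have hml₁ : m = l₁ := by rw [hm, hAx, real_inner_smul_right, hxx, mul_one]
    have hg0 : g = 0 := by rw [hg, hAx, hml₁, smul_smul, sub_self]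
    rw [hg0, hw, ← h0]
    simp
  have hs0 : 0 < s := Real.sin_pos_of_pos_of_lt_pi hpos (by linarith [Real.pi_pos])
  have hwn : ‖w‖ ^ 2 = θ ^ 2 := by
    rw [hw, norm_smul, mul_pow, hy, Real.norm_eq_abs, sq_abs, ← mul_pow, div_mul_cancel₀ _ hs0.ne']
  set D := (l₁ - m) / s ^ 2 with hD
  have hDs : l₁ - m = D * s ^ 2 := (div_mul_cancel₀ _ (pow_pos hs0 2).ne').symm
  have hDδ : l₁ - l₂ ≤ D := by
    rw [hD, le_div_iff₀ (pow_pos hs0 2)]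
    linarith [congrArg (l₁ * ·) hs2]
  have hD0 : 0 < D := hgap.trans_le hDδ
  have hl₁ : 0 < l₁ := by linarith [mul_pos hD0 (pow_pos hs0 2)]
  have hAx : ‖A x‖ ^ 2 ≤ l₁ * m := norm_sq_apply_le_mul_inner A hsymm hpsd hl₁
    (fun u => inner_apply_le_mul_norm_sq A (hmax _)) x
  have hG' : ‖g‖ ^ 2 ≤ 4 * l₁ * (D * s ^ 2) := by
    rw [hG, ← hDs]
    linarith [mul_le_mul_of_nonneg_right hml (sub_nonneg.2 hml)]
  have hηl : 2 * (η * l₁) ≤ a := by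
    have h := (le_div_iff₀ (by linarith)).1 hη
    linarith [mul_le_mul_of_nonneg_left hγ hη0.le]
  have hsθ : s ≤ θ := Real.sin_le hθ0
  have hθs : θ ≤ 2 * s := by
    have h := Real.mul_le_sin hθ0 hθ2
    rw [div_mul_eq_mul_div, div_le_iff₀ Real.pi_pos] at h
    linarith [mul_le_mul_of_nonneg_left Real.pi_le_four hs0.le]
  have hcross : 2 * η * ⟪g, w⟫ = -(η * (4 * c * D * (θ * s))) := by
    rw [hgw, hDs]
    field_simp
    ring
  rw [hexp, hcross, hwn]
  have h1 : η ^ 2 * ‖g‖ ^ 2 ≤ η * (2 * a * D * (θ * s)) := by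
    calc η ^ 2 * ‖g‖ ^ 2 ≤ η ^ 2 * (4 * l₁ * (D * s ^ 2)) := by gcongr
      _ = η * (2 * (2 * (η * l₁)) * D * (s * s)) := by ring
      _ ≤ _ := by gcongr
  have h2 : η * (2 * a * D * (θ * s)) ≤ η * (2 * c * D * (θ * s)) := by gcongr
  have h3 : η * (a * (l₁ - l₂) * (θ * θ)) ≤ η * (c * D * (θ * (2 * s))) := by gcongr
  have h4 : 0 ≤ η * (a * (l₁ - l₂) * (θ * θ)) := by positivity
  linarith
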